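/- Let q be a positive natural number and let p be a natural number with 0 ≤ p < q. Let N be a random variable uniformly distributed on {0, 1, …, q − 1}. Then ⌊(p + N)/q⌋ takes only the values 0 and 1, it equals 1 with probability p/q, and its expected value equals p/q. Consequently, adding uniform stochastic noise to a value and then truncating implements stochastic rounding exactly. -/

import Mathlib

/-- For `p, n < q`, the quotient `(p + n) / q` is the carry bit of `p + n` in base `q`. -/
lemma Nat.add_div_eq_zero_or_one {q p n : ℕ} (hp : p < q) (hn : n < q) :
    (p + n) / q = 0 ∨ (p + n) / q = 1 := by
  have : (p + n) / q < 2 := Nat.div_lt_of_lt_mul (by omega)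
  exact Nat.le_one_iff_eq_zero_or_eq_one.mp (Nat.lt_succ_iff.mp this)

/-- Exactly `p` of the numbers `0, …, q - 1` produce a carry when added to `p < q`. -/
lemma Finset.card_range_filter_add_div_eq_one {q p : ℕ} (hp : p < q) :
    ((Finset.range q).filter fun n => (p + n) / q = 1).card = p := by
  have : ((Finset.range q).filter fun n => (p + n) / q = 1) = Finset.Ico (q - p) q := by
    ext n
    simp only [Finset.mem_filter, Finset.mem_range, Finset.mem_Ico,
      Nat.div_eq_iff (by omega : 0 < q)]
    omega
  rw [this, Nat.card_Ico]
  omega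

/-- The uniform measure on a finite set is concentrated on that set. -/
lemma PMF.ae_mem_uniformOfFinset {α : Type*} [MeasurableSpace α] [DiscreteMeasurableSpace α]
    (s : Finset α) (hs : s.Nonempty) :
    ∀ᵐ a ∂(PMF.uniformOfFinset s hs).toMeasure, a ∈ s := by
  rw [MeasureTheory.ae_iff, PMF.toMeasure_apply_eq_zero_iff _ (MeasurableSet.of_discrete),
    PMF.support_uniformOfFinset]
  exact Set.disjoint_left.mpr fun a ha h => h ha

/-- Let `N` be uniform on `{0, …, q - 1}` and `0 ≤ p < q`. Then `⌊(p + N)/q⌋`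
takes only the values `0` and `1`, it equals `1` with probability `p / q`, and
its expected value equals `p / q`: adding uniform stochastic noise and then
truncating implements stochastic rounding exactly. -/
theorem add_noise_truncate_is_stochastic_rounding (q p : ℕ) (hq : 0 < q) (hp : p < q) :
    (∀ n, n < q → (p + n) / q = 0 ∨ (p + n) / q = 1) ∧
    (PMF.uniformOfFinset (Finset.range q)
        (Finset.nonempty_range_iff.mpr hq.ne')).toMeasure {n | (p + n) / q = 1}
      = (p : ENNReal) / (q : ENNReal) ∧
    (∫ n, (((p + n) / q : ℕ) : ℝ)
        ∂(PMF.uniformOfFinset (Finset.range q)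
            (Finset.nonempty_range_iff.mpr hq.ne')).toMeasure)
      = (p : ℝ) / (q : ℝ) := by
  have hprob : (PMF.uniformOfFinset (Finset.range q)
      (Finset.nonempty_range_iff.mpr hq.ne')).toMeasure {n | (p + n) / q = 1}
      = (p : ENNReal) / (q : ENNReal) := by
    classical
    rw [PMF.toMeasure_uniformOfFinset_apply _ _ MeasurableSet.of_discrete, Finset.card_range]
    congr 2
    convert Finset.card_range_filter_add_div_eq_one hp
    exact Iff.rfl
  refine ⟨fun n hn => Nat.add_div_eq_zero_or_one hp hn, hprob, ?_⟩
  rw [MeasureTheory.integral_congr_ae (g := Set.indicator {n | (p + n) / q = 1} 1),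
    MeasureTheory.integral_indicator_one MeasurableSet.of_discrete, MeasureTheory.measureReal_def,
    hprob, ENNReal.toReal_div, ENNReal.toReal_natCast, ENNReal.toReal_natCast]
  filter_upwards [PMF.ae_mem_uniformOfFinset (Finset.range q) _] with n hn
  rcases Nat.add_div_eq_zero_or_one hp (Finset.mem_range.mp hn) with h | h <;>
    simp [h]
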